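/- For every real x ≠ 0, ∫_0^∞ ∫_0^∞ 1{|x| ≤ t} · e^{−(t+s)}/(t + s) dt ds = e^{−|x|} − |x| E₁(|x|), where E₁(r) := ∫_r^∞ e^{−s}/s ds is the exponential integral. Equivalently, if T₀ and T₁ are independent exponential random variables with rate 1, then E[1{|x| ≤ T₀}/(T₀ + T₁)] = e^{−|x|} − |x| E₁(|x|). -/

import Mathlib

open MeasureTheory

/-- The exponential integral `E₁(r) = ∫_r^∞ e^{-s}/s ds`. -/
noncomputable def E1 (r : ℝ) : ℝ := ∫ s in Set.Ioi r, Real.exp (-s) / s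

open Filter Topology

theorem integrableOn_exp_neg_div {a : ℝ} (ha : 0 < a) :
    IntegrableOn (fun s => Real.exp (-s) / s) (Set.Ioi a) := by
  refine ((integrableOn_exp_neg_Ioi a).div_const a).mono'
    (Measurable.aestronglyMeasurable (by fun_prop)) (ae_restrict_of_forall_mem measurableSet_Ioi fun s hs => ?_)
  have hs : a < s := hs
  rw [Real.norm_of_nonneg (div_nonneg (Real.exp_pos _).le (ha.trans hs).le)]
  gcongr

theorem E1_nonneg {r : ℝ} (hr : 0 ≤ r) : 0 ≤ E1 r :=
  setIntegral_nonneg measurableSet_Ioi fun _ hs =>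
    div_nonneg (Real.exp_pos _).le (hr.trans_lt hs).le

theorem mul_E1_le_exp_neg {r : ℝ} (hr : 0 < r) : r * E1 r ≤ Real.exp (-r) := by
  rw [E1, ← integral_const_mul, ← integral_exp_neg_Ioi r]
  refine setIntegral_mono_on ((integrableOn_exp_neg_div hr).const_mul r)
    (integrableOn_exp_neg_Ioi r) measurableSet_Ioi fun s hs => ?_
  have hs : r < s := hs
  rw [mul_div_left_comm]
  exact mul_le_of_le_one_right (Real.exp_pos _).le ((div_le_one (hr.trans hs)).mpr hs.le)

theorem hasDerivAt_E1 {u : ℝ} (hu : 0 < u) : HasDerivAt E1 (-(Real.exp (-u) / u)) u := by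
  have hcont : ∀ v : ℝ, 0 < v → ContinuousAt (fun s => Real.exp (-s) / s) v := fun v hv =>
    ContinuousAt.div (by fun_prop) continuousAt_id hv.ne'
  have hmeas : StronglyMeasurable fun s : ℝ => Real.exp (-s) / s :=
    Measurable.stronglyMeasurable (by fun_prop)
  have hd := (intervalIntegral.integral_hasDerivAt_right
    (IntervalIntegrable.refl (μ := volume) (a := u)) hmeas.stronglyMeasurableAtFilter
    (hcont u hu)).const_sub (E1 u)
  refine hd.congr_of_eventuallyEq ?_
  filter_upwards [lt_mem_nhds hu] with v hv
  rw [← intervalIntegral.integral_Ioi_sub_Ioi' (integrableOn_exp_neg_div hu)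
    (integrableOn_exp_neg_div hv), E1, E1, sub_sub_cancel]

theorem hasDerivAt_mul_E1_sub_exp_neg {u : ℝ} (hu : 0 < u) :
    HasDerivAt (fun v => v * E1 v - Real.exp (-v)) (E1 u) u := by
  refine (((hasDerivAt_id u).mul (hasDerivAt_E1 hu)).sub (hasDerivAt_neg u).exp).congr_deriv ?_
  simp only [id_eq]
  field_simp
  ring

theorem tendsto_mul_E1_sub_exp_neg :
    Tendsto (fun v => v * E1 v - Real.exp (-v)) atTop (𝓝 0) := by
  have hexp : Tendsto (fun v : ℝ => Real.exp (-v)) atTop (𝓝 0) :=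
    Real.tendsto_exp_neg_atTop_nhds_zero
  have hmul : Tendsto (fun v => v * E1 v) atTop (𝓝 0) := by
    refine squeeze_zero' ?_ ?_ hexp
    · filter_upwards [eventually_ge_atTop 0] with v hv using mul_nonneg hv (E1_nonneg hv)
    · filter_upwards [eventually_gt_atTop 0] with v hv using mul_E1_le_exp_neg hv
  simpa using hmul.sub hexp

theorem integral_ite_exp_neg_add_div_add {r : ℝ} (hr : 0 < r) (s : ℝ) :
    ∫ t in Set.Ioi (0 : ℝ), (if r ≤ t then Real.exp (-(t + s)) / (t + s) else 0) =
      E1 (r + s) := by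
  have hind : (fun t => if r ≤ t then Real.exp (-(t + s)) / (t + s) else 0) =
      (Set.Ici r).indicator fun t => Real.exp (-(t + s)) / (t + s) := rfl
  have hsub : Set.Ioi (0 : ℝ) ∩ Set.Ici r = Set.Ici r :=
    Set.inter_eq_right.mpr fun t ht => hr.trans_le ht
  have hpre : (fun t => t + s) ⁻¹' Set.Ioi (r + s) = Set.Ioi r := by
    ext t
    simp
  rw [hind, setIntegral_indicator measurableSet_Ici, hsub, integral_Ici_eq_integral_Ioi, E1,
    ← hpre]
  exact (measurePreserving_add_right volume s).setIntegral_preimage_emb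
    (measurableEmbedding_addRight s) (fun u => Real.exp (-u) / u) _

/-- For every real `x ≠ 0`,
`∫_0^∞ ∫_0^∞ 1{|x| ≤ t} e^{-(t+s)}/(t+s) dt ds = e^{-|x|} - |x| E₁(|x|)`;
equivalently, if `T₀, T₁` are independent rate-1 exponential random variables,
then `E[1{|x| ≤ T₀}/(T₀ + T₁)] = e^{-|x|} - |x| E₁(|x|)`. -/
theorem double_exponential_integral_eq
    (x : ℝ) (hx : x ≠ 0) :
    (∫ s in Set.Ioi (0 : ℝ), ∫ t in Set.Ioi (0 : ℝ),
        (if |x| ≤ t then Real.exp (-(t + s)) / (t + s) else 0))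
      = Real.exp (-|x|) - |x| * E1 |x| := by
  have hr : 0 < |x| := abs_pos.mpr hx
  rw [setIntegral_congr_fun measurableSet_Ioi
    fun s _ => integral_ite_exp_neg_add_div_add hr s]
  rw [integral_Ioi_of_hasDerivAt_of_nonneg' (l := 0)
    (g := fun s => (|x| + s) * E1 (|x| + s) - Real.exp (-(|x| + s)))]
  · simp
  · intro s hs
    exact (hasDerivAt_mul_E1_sub_exp_neg (add_pos_of_pos_of_nonneg hr hs)).comp_const_add |x| s
  · intro s hs
    exact E1_nonneg (add_pos hr hs).le
  · exact tendsto_mul_E1_sub_exp_neg.comp (tendsto_atTop_add_const_left _ |x| tendsto_id)
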